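/- Let k be a field and n, m ≥ 1, and let D be the set of minimal-length representatives of the right cosets (S_n × S_m)\S_{n+m} of the Young subgroup S_n × S_m in the symmetric group S_{n+m}. Then the k-linear map (NH_n ⊗_k NH_m) ⊗_k k^{(D)} → NH_{n+m} sending a ⊗ δ_w ↦ φ(a)·∂_w is bijective; equivalently, NH_{n+m} is a free left (NH_n ⊗_k NH_m)-module (via φ) with basis {∂_w : w ∈ D}. -/

import Mathlib

open scoped TensorProduct

/-! ## The nilHecke algebra

For a field `k` and `N : ℕ`, the nilHecke algebra `NH k N` is the quotient of the free
associative `k`-algebra on generators `x_0, …, x_{N-1}` (indexed by `Fin N`) and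
`∂_0, …, ∂_{N-2}` (indexed by `{i : Fin N // i + 1 < N}`) by the nilHecke relations. -/

/-- Index type for the generators `∂_i` of the nilHecke algebra on `N` strands. -/
abbrev DIdx (N : ℕ) : Type := {i : Fin N // (i : ℕ) + 1 < N}

/-- The generators of the nilHecke algebra: `Sum.inl i` is `x_i`, `Sum.inr j` is `∂_j`. -/
abbrev NHGen (N : ℕ) : Type := Fin N ⊕ DIdx N

variable (k : Type) [Field k]

/-- `x_i` in the free algebra. -/
noncomputable abbrev NHx (N : ℕ) (i : Fin N) : FreeAlgebra k (NHGen N) :=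
  FreeAlgebra.ι k (Sum.inl i)

/-- `∂_i` in the free algebra. -/
noncomputable abbrev NHd (N : ℕ) (i : DIdx N) : FreeAlgebra k (NHGen N) :=
  FreeAlgebra.ι k (Sum.inr i)

/-- For `i` an index of a `∂` generator, the element `i+1` of `Fin N`. -/
abbrev DIdx.succ {N : ℕ} (i : DIdx N) : Fin N := ⟨(i.1 : ℕ) + 1, i.2⟩

/-- The defining relations of the nilHecke algebra:
`x_i x_j = x_j x_i`; `∂_i² = 0`; `∂_i ∂_{i+1} ∂_i = ∂_{i+1} ∂_i ∂_{i+1}`;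
`∂_i ∂_j = ∂_j ∂_i` for `|i-j| > 1`; `x_i ∂_j = ∂_j x_i` for `|i-j| > 1`;
`x_i ∂_i - ∂_i x_{i+1} = 1`; `∂_i x_i - x_{i+1} ∂_i = 1`. -/
inductive NHRel (N : ℕ) : FreeAlgebra k (NHGen N) → FreeAlgebra k (NHGen N) → Prop
  | xcomm (i j : Fin N) : NHRel N (NHx k N i * NHx k N j) (NHx k N j * NHx k N i)
  | dsq (i : DIdx N) : NHRel N (NHd k N i * NHd k N i) 0
  | braid (i j : DIdx N) (h : (j.1 : ℕ) = (i.1 : ℕ) + 1) :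
      NHRel N (NHd k N i * NHd k N j * NHd k N i) (NHd k N j * NHd k N i * NHd k N j)
  | ddfar (i j : DIdx N) (h : (i.1 : ℕ) + 1 < (j.1 : ℕ) ∨ (j.1 : ℕ) + 1 < (i.1 : ℕ)) :
      NHRel N (NHd k N i * NHd k N j) (NHd k N j * NHd k N i)
  | xdfar (i : Fin N) (j : DIdx N)
      (h : (i : ℕ) + 1 < (j.1 : ℕ) ∨ (j.1 : ℕ) + 1 < (i : ℕ)) :
      NHRel N (NHx k N i * NHd k N j) (NHd k N j * NHx k N i)
  | xd (i : DIdx N) :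
      NHRel N (NHx k N i.1 * NHd k N i - NHd k N i * NHx k N i.succ) 1
  | dx (i : DIdx N) :
      NHRel N (NHd k N i * NHx k N i.1 - NHx k N i.succ * NHd k N i) 1

/-- The nilHecke algebra on `N` strands over `k`. -/
noncomputable def NH (N : ℕ) : Type := RingQuot (NHRel k N)

noncomputable instance (N : ℕ) : Ring (NH k N) :=
  inferInstanceAs (Ring (RingQuot (NHRel k N)))

noncomputable instance (N : ℕ) : Algebra k (NH k N) :=
  inferInstanceAs (Algebra k (RingQuot (NHRel k N)))

/-- The generator `x_i` of the nilHecke algebra `NH k N`. -/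
noncomputable def xg (N : ℕ) (i : Fin N) : NH k N :=
  RingQuot.mkAlgHom k (NHRel k N) (NHx k N i)

/-- The generator `∂_i` of the nilHecke algebra `NH k N`. -/
noncomputable def dg (N : ℕ) (i : DIdx N) : NH k N :=
  RingQuot.mkAlgHom k (NHRel k N) (NHd k N i)


/-- `IsDfam k N Dm` says that `Dm : S_N → NH_N` is the family `w ↦ ∂_w`, defined via
reduced expressions: it is characterized by `∂_1 = 1` together with
`∂_{w s_i} = ∂_w · ∂_i` whenever `ℓ(w s_i) = ℓ(w) + 1`, i.e. whenever `w(i) < w(i+1)`. -/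
def IsDfam (N : ℕ) (Dm : Equiv.Perm (Fin N) → NH k N) : Prop :=
  Dm 1 = 1 ∧ ∀ (w : Equiv.Perm (Fin N)) (i : DIdx N),
    w i.1 < w i.succ → Dm (w * Equiv.swap i.1 i.succ) = Dm w * dg k N i

/-- The element `e_N = x_1^{N-1} x_2^{N-2} ⋯ x_{N-1} ∂_{w_0} ∈ NH_N` (0-indexed:
`x_i` appears with exponent `N-1-i`), where `w_0 = Fin.revPerm` is the longest element
of `S_N` and `Dm = (∂_w)_w` is the family of divided difference elements. -/
noncomputable def eElt (N : ℕ) (Dm : Equiv.Perm (Fin N) → NH k N) : NH k N :=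
  (List.ofFn fun i : Fin N => xg k N i ^ (N - 1 - (i : ℕ))).prod * Dm Fin.revPerm

/-- `IsPhi k n m φ` says that the `k`-algebra homomorphism
`φ : NH_n ⊗_k NH_m → NH_{n+m}` is the canonical one, with `φ(x_i ⊗ 1) = x_i`,
`φ(∂_i ⊗ 1) = ∂_i`, `φ(1 ⊗ x_j) = x_{n+j}` and `φ(1 ⊗ ∂_j) = ∂_{n+j}`. -/
def IsPhi (n m : ℕ) (φ : NH k n ⊗[k] NH k m →ₐ[k] NH k (n + m)) : Prop :=
  (∀ i : Fin n, φ (xg k n i ⊗ₜ[k] 1) = xg k (n + m) (Fin.castAdd m i)) ∧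
  (∀ j : DIdx n, φ (dg k n j ⊗ₜ[k] 1)
      = dg k (n + m) ⟨Fin.castAdd m j.1,
          by have := j.2; simp only [Fin.coe_castAdd]; omega⟩) ∧
  (∀ i : Fin m, φ ((1 : NH k n) ⊗ₜ[k] xg k m i) = xg k (n + m) (Fin.natAdd n i)) ∧
  (∀ j : DIdx m, φ ((1 : NH k n) ⊗ₜ[k] dg k m j)
      = dg k (n + m) ⟨Fin.natAdd n j.1,
          by have := j.2; simp only [Fin.coe_natAdd]; omega⟩)

/-- The number of inversions (= Coxeter length) of a permutation of `Fin N`. -/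
def permLength (N : ℕ) (w : Equiv.Perm (Fin N)) : ℕ :=
  (Finset.univ.filter fun p : Fin N × Fin N => p.1 < p.2 ∧ w p.2 < w p.1).card

/-- The Young subgroup `S_n × S_m ⊆ S_{n+m}`: the permutations preserving the first
block `{0, …, n-1}` (hence also the second block). -/
def young (n m : ℕ) : Set (Equiv.Perm (Fin (n + m))) :=
  {w | ∀ i : Fin (n + m), (i : ℕ) < n → (w i : ℕ) < n}

/-- The set of minimal-length representatives of the right cosets
`(S_n × S_m)\S_{n+m}`: permutations of minimal length in their coset. -/
def minReps (n m : ℕ) : Set (Equiv.Perm (Fin (n + m))) :=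
  {w | ∀ v : Equiv.Perm (Fin (n + m)), v * w⁻¹ ∈ young n m →
    permLength (n + m) w ≤ permLength (n + m) v}

/-! ### Permutations and adjacent transpositions -/

/-- The adjacent transposition `(i, i + 1)`. -/
abbrev adjSwap {N : ℕ} (i : DIdx N) : Equiv.Perm (Fin N) := Equiv.swap i.1 i.succ

lemma DIdx.lt_succ {N : ℕ} (i : DIdx N) : i.1 < i.succ := by
  simp [Fin.lt_def]

lemma adjSwap_lt_adjSwap {N : ℕ} (i : DIdx N) {a b : Fin N} (hab : a < b)
    (h : ¬ (a = i.1 ∧ b = i.succ)) : adjSwap i a < adjSwap i b := by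
  obtain ⟨⟨i, hi⟩, hi'⟩ := i
  simp only [Equiv.swap_apply_def, DIdx.succ, Fin.ext_iff, Fin.lt_def] at *
  split_ifs <;> simp <;> omega

@[simp] lemma adjSwap_apply_left {N : ℕ} (i : DIdx N) : adjSwap i i.1 = i.succ :=
  Equiv.swap_apply_left _ _

@[simp] lemma adjSwap_apply_right {N : ℕ} (i : DIdx N) : adjSwap i i.succ = i.1 :=
  Equiv.swap_apply_right _ _

@[simp] lemma adjSwap_adjSwap {N : ℕ} (i : DIdx N) (a : Fin N) :
    adjSwap i (adjSwap i a) = a :=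
  Equiv.swap_apply_self _ _ _

/-- The set of inversions of a permutation. -/
def inversions {N : ℕ} (w : Equiv.Perm (Fin N)) : Finset (Fin N × Fin N) :=
  Finset.univ.filter fun p : Fin N × Fin N => p.1 < p.2 ∧ w p.2 < w p.1

lemma mem_inversions {N : ℕ} {w : Equiv.Perm (Fin N)} {p : Fin N × Fin N} :
    p ∈ inversions w ↔ p.1 < p.2 ∧ w p.2 < w p.1 := by
  simp [inversions]

lemma permLength_lt_of_ssubset {N : ℕ} {v w : Equiv.Perm (Fin N)}
    (h : inversions v ⊂ inversions w) : permLength N v < permLength N w :=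
  Finset.card_lt_card h

lemma permLength_lt_mul_adjSwap {N : ℕ} (w : Equiv.Perm (Fin N)) (i : DIdx N)
    (h : w i.1 < w i.succ) : permLength N w < permLength N (w * adjSwap i) := by
  change (inversions w).card < (inversions (w * adjSwap i)).card
  rw [← Finset.card_map ((adjSwap i).prodCongr (adjSwap i)).toEmbedding]
  refine Finset.card_lt_card ((Finset.ssubset_iff_of_subset ?_).mpr
    ⟨(i.1, i.succ), ?_, ?_⟩)
  · intro p hp
    obtain ⟨q, hq, rfl⟩ := Finset.mem_map.mp hp
    rw [mem_inversions] at hq ⊢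
    refine ⟨adjSwap_lt_adjSwap i hq.1 ?_, by simpa using hq.2⟩
    rintro ⟨h1, h2⟩
    rw [h1, h2] at hq
    exact lt_asymm h hq.2
  · rw [mem_inversions]
    exact ⟨i.lt_succ, by simpa using h⟩
  · intro hmem
    obtain ⟨q, hq, he⟩ := Finset.mem_map.mp hmem
    rw [mem_inversions] at hq
    simp only [Equiv.coe_toEmbedding, Equiv.prodCongr_apply, Prod.map, Prod.mk.injEq] at he
    have h1 : q.1 = i.succ := by
      rw [← adjSwap_adjSwap i q.1, he.1, adjSwap_apply_left]
    have h2 : q.2 = i.1 := by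
      rw [← adjSwap_adjSwap i q.2, he.2, adjSwap_apply_right]
    rw [h1, h2] at hq
    exact lt_asymm hq.1 i.lt_succ

lemma permLength_adjSwap_mul_lt {N : ℕ} (w : Equiv.Perm (Fin N)) (i : DIdx N)
    (h : w⁻¹ i.succ < w⁻¹ i.1) : permLength N (adjSwap i * w) < permLength N w := by
  refine permLength_lt_of_ssubset ((Finset.ssubset_iff_of_subset ?_).mpr
    ⟨(w⁻¹ i.succ, w⁻¹ i.1), ?_, ?_⟩)
  · intro p hp
    rw [mem_inversions, Equiv.Perm.mul_apply, Equiv.Perm.mul_apply] at hp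
    rw [mem_inversions]
    refine ⟨hp.1, ?_⟩
    by_contra hlt
    have hlt' : w p.1 < w p.2 :=
      lt_of_le_of_ne (not_lt.mp hlt) fun he => hp.1.ne (w.injective he)
    refine lt_asymm hp.2 (adjSwap_lt_adjSwap i hlt' ?_)
    rintro ⟨h1, h2⟩
    rw [← h1, ← h2] at h
    exact lt_asymm hp.1 (by simpa using h)
  · rw [mem_inversions]
    exact ⟨h, by simpa using i.lt_succ⟩
  · intro hmem
    rw [mem_inversions] at hmem
    exact lt_asymm i.lt_succ (by simpa using hmem.2)

lemma strictMono_of_lt_dIdx_succ {N : ℕ} {w : Fin N → Fin N}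
    (h : ∀ i : DIdx N, w i.1 < w i.succ) : StrictMono w := by
  cases N with
  | zero => exact fun a => a.elim0
  | succ N =>
    refine Fin.strictMono_iff_lt_succ.mpr fun i => ?_
    exact h ⟨i.castSucc, by simp⟩

lemma perm_eq_one_of_strictMono {N : ℕ} {w : Equiv.Perm (Fin N)} (h : StrictMono w) :
    w = 1 := by
  exact Equiv.ext fun i => le_antisymm (h.le_id i) (h.id_le i)

lemma exists_descent {N : ℕ} {w : Equiv.Perm (Fin N)} (hw : w ≠ 1) :
    ∃ i : DIdx N, w i.succ < w i.1 := by
  by_contra! h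
  exact hw (perm_eq_one_of_strictMono (strictMono_of_lt_dIdx_succ fun i =>
    lt_of_le_of_ne (h i) fun he => i.lt_succ.ne (w.injective he)))

lemma mul_adjSwap_lt {N : ℕ} (w : Equiv.Perm (Fin N)) (i : DIdx N)
    (h : w i.succ < w i.1) : (w * adjSwap i) i.1 < (w * adjSwap i) i.succ := by
  simpa using h

lemma mul_adjSwap_cancel {N : ℕ} (w : Equiv.Perm (Fin N)) (i : DIdx N) :
    w * adjSwap i * adjSwap i = w := by
  rw [mul_assoc, Equiv.swap_mul_self, mul_one]

lemma permLength_mul_adjSwap_lt {N : ℕ} (w : Equiv.Perm (Fin N)) (i : DIdx N)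
    (h : w i.succ < w i.1) : permLength N (w * adjSwap i) < permLength N w := by
  simpa only [mul_adjSwap_cancel] using
    permLength_lt_mul_adjSwap (w * adjSwap i) i (mul_adjSwap_lt w i h)

/-- Every permutation is reached from `1` by length-increasing right multiplications by
adjacent transpositions. -/
theorem perm_ascent_induction {N : ℕ} {P : Equiv.Perm (Fin N) → Prop} (one : P 1)
    (step : ∀ (w : Equiv.Perm (Fin N)) (i : DIdx N), w i.1 < w i.succ → P w →
      P (w * adjSwap i)) (w : Equiv.Perm (Fin N)) : P w := by
  induction hl : permLength N w using Nat.strong_induction_on generalizing w with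
  | _ l ih =>
    by_cases hw : w = 1
    · exact hw ▸ one
    · obtain ⟨i, hi⟩ := exists_descent hw
      rw [← mul_adjSwap_cancel w i]
      exact step _ i (mul_adjSwap_lt w i hi)
        (ih _ (hl ▸ permLength_mul_adjSwap_lt w i hi) _ rfl)

/-! ### Relations in the nilHecke algebra -/

/-- The quotient map from the free algebra to the nilHecke algebra. -/
noncomputable def nhMk (N : ℕ) : FreeAlgebra k (NHGen N) →ₐ[k] NH k N :=
  RingQuot.mkAlgHom k (NHRel k N)

lemma nhMk_rel {N : ℕ} {a b : FreeAlgebra k (NHGen N)} (h : NHRel k N a b) :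
    nhMk k N a = nhMk k N b :=
  RingQuot.mkAlgHom_rel k h

lemma nhMk_surjective (N : ℕ) : Function.Surjective (nhMk k N) :=
  RingQuot.mkAlgHom_surjective k (NHRel k N)

lemma nhMk_x (N : ℕ) (i : Fin N) : nhMk k N (NHx k N i) = xg k N i := rfl

lemma nhMk_d (N : ℕ) (i : DIdx N) : nhMk k N (NHd k N i) = dg k N i := rfl

lemma dg_mul_self (N : ℕ) (i : DIdx N) : dg k N i * dg k N i = 0 := by
  have := nhMk_rel k (NHRel.dsq (k := k) i)
  simpa only [map_mul, map_zero, nhMk_x, nhMk_d] using this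

lemma xg_comm (N : ℕ) (i j : Fin N) : xg k N i * xg k N j = xg k N j * xg k N i := by
  have := nhMk_rel k (NHRel.xcomm (k := k) i j)
  simpa only [map_mul, nhMk_x, nhMk_d] using this

lemma dg_braid (N : ℕ) (i j : DIdx N) (h : (j.1 : ℕ) = (i.1 : ℕ) + 1) :
    dg k N i * dg k N j * dg k N i = dg k N j * dg k N i * dg k N j := by
  have := nhMk_rel k (NHRel.braid (k := k) i j h)
  simpa only [map_mul, nhMk_x, nhMk_d] using this

lemma dg_comm (N : ℕ) (i j : DIdx N)
    (h : (i.1 : ℕ) + 1 < (j.1 : ℕ) ∨ (j.1 : ℕ) + 1 < (i.1 : ℕ)) :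
    dg k N i * dg k N j = dg k N j * dg k N i := by
  have := nhMk_rel k (NHRel.ddfar (k := k) i j h)
  simpa only [map_mul, nhMk_x, nhMk_d] using this

lemma xg_dg_comm_of_far (N : ℕ) (i : Fin N) (j : DIdx N)
    (h : (i : ℕ) + 1 < (j.1 : ℕ) ∨ (j.1 : ℕ) + 1 < (i : ℕ)) :
    xg k N i * dg k N j = dg k N j * xg k N i := by
  have := nhMk_rel k (NHRel.xdfar (k := k) i j h)
  simpa only [map_mul, nhMk_x, nhMk_d] using this

lemma dg_mul_xg_succ (N : ℕ) (i : DIdx N) :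
    dg k N i * xg k N i.succ = xg k N i.1 * dg k N i - 1 := by
  have := nhMk_rel k (NHRel.xd (k := k) i)
  simp only [map_mul, map_sub, map_one, nhMk_x, nhMk_d] at this
  rw [← this]; abel

lemma dg_mul_xg_self (N : ℕ) (i : DIdx N) :
    dg k N i * xg k N i.1 = xg k N i.succ * dg k N i + 1 := by
  have := nhMk_rel k (NHRel.dx (k := k) i)
  simp only [map_mul, map_sub, map_one, nhMk_x, nhMk_d] at this
  rw [← this]; abel

/-- The commutation of `x` and `∂'` follows from the other nilHecke relations on three
strands `x, y, z`, with `∂` acting on `x, y` and `∂'` on `y, z`. -/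
lemma comm_of_nilHecke_relations {R : Type*} [Ring R] {x y z d e : R}
    (hxy : x * y = y * x) (hxz : x * z = z * x)
    (hzd : z * d = d * z) (hdd : d * d = 0) (hee : e * e = 0)
    (hdy : d * y = x * d - 1) (hdx : d * x = y * d + 1)
    (hez : e * z = y * e - 1) (hey : e * y = z * e + 1)
    (hb : d * e * d = e * d * e) : x * e = e * x := by
  have hxd : x * d = d * y + 1 := by rw [hdy]; abel
  have hzc : z * (x * e - e * x) = (x * e - e * x) * y := by
    have h1 : z * (x * e) = x * (z * e) := by rw [← mul_assoc, ← hxz, mul_assoc]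
    have h2 : z * e = e * y - 1 := by rw [hey]; abel
    have h3 : z * (e * x) = (z * e) * x := by rw [mul_assoc]
    have h4 : e * x * y = e * y * x := by rw [mul_assoc, hxy, ← mul_assoc]
    calc z * (x * e - e * x) = z * (x * e) - z * (e * x) := mul_sub _ _ _
      _ = x * e * y - e * y * x := by rw [h1, h3, h2]; noncomm_ring
      _ = _ := by rw [sub_mul, h4]
  have hcde : (x * e - e * x) * d * e = 0 := by
    have h1 : x * (d * e * d) = (d * e * d) * z + e * d := by
      calc x * (d * e * d) = (x * d) * e * d := by noncomm_ring
        _ = d * (y * e) * d + e * d := by rw [hxd]; noncomm_ring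
        _ = d * (e * z + 1) * d + e * d := by rw [hez]; noncomm_ring
        _ = d * e * (z * d) + d * d + e * d := by noncomm_ring
        _ = _ := by rw [hzd, hdd]; noncomm_ring
    have h2 : (e * d * e) * z = e * x * d * e - e * d := by
      calc (e * d * e) * z = e * d * (e * z) := by noncomm_ring
        _ = e * (d * y) * e - e * d := by rw [hez]; noncomm_ring
        _ = e * x * d * e - e * e - e * d := by rw [hdy]; noncomm_ring
        _ = _ := by rw [hee]; noncomm_ring
    rw [hb] at h1
    rw [h2] at h1
    calc (x * e - e * x) * d * e = x * (e * d * e) - e * x * d * e := by noncomm_ring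
      _ = 0 := by rw [h1]; abel
  have hcz : (x * e - e * x) * z = y * (x * e - e * x) := by
    calc (x * e - e * x) * z = x * (e * z) - e * (x * z) := by noncomm_ring
      _ = x * (e * z) - (e * z) * x := by rw [hxz]; noncomm_ring
      _ = (x * y) * e - y * e * x := by rw [hez]; noncomm_ring
      _ = _ := by rw [hxy]; noncomm_ring
  have hcd : (x * e - e * x) * d = 0 := by
    calc (x * e - e * x) * d
        = (x * e - e * x) * d * (e * y) - (x * e - e * x) * (d * z) * e := by
          rw [hey]; noncomm_ring
      _ = (x * e - e * x) * d * e * y - ((x * e - e * x) * z) * d * e := by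
          rw [← hzd]; noncomm_ring
      _ = (x * e - e * x) * d * e * y - y * ((x * e - e * x) * d * e) := by
          rw [hcz]; noncomm_ring
      _ = 0 := by rw [hcde]; simp
  have hc : x * e - e * x = 0 := by
    calc x * e - e * x
        = (x * e - e * x) * (d * x) - (x * e - e * x) * y * d := by
          rw [hdx]; noncomm_ring
      _ = (x * e - e * x) * d * x - z * ((x * e - e * x) * d) := by
          rw [← hzc]; noncomm_ring
      _ = 0 := by rw [hcd]; simp
  exact sub_eq_zero.mp hc

lemma xg_dg_comm (N : ℕ) (i : Fin N) (j : DIdx N) (h1 : i ≠ j.1) (h2 : i ≠ j.succ) :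
    xg k N i * dg k N j = dg k N j * xg k N i := by
  by_cases hfar : (i : ℕ) + 1 < (j.1 : ℕ) ∨ (j.1 : ℕ) + 1 < (i : ℕ)
  · exact xg_dg_comm_of_far k N i j hfar
  have hi : (i : ℕ) + 1 = j.1 := by
    simp only [ne_eq, Fin.ext_iff] at h1 h2
    omega
  have hiN : (i : ℕ) + 1 < N := hi ▸ j.1.2
  let i' : DIdx N := ⟨i, hiN⟩
  have hi' : i'.succ = j.1 := Fin.ext hi
  have hdy := dg_mul_xg_succ k N i'
  have hdx := dg_mul_xg_self k N i'
  rw [hi'] at hdy hdx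
  refine comm_of_nilHecke_relations (xg_comm k N _ _) (xg_comm k N _ _)
    (xg_dg_comm_of_far k N j.succ i' (Or.inr ?_)) (dg_mul_self k N i') (dg_mul_self k N j)
    hdy hdx (dg_mul_xg_succ k N j) (dg_mul_xg_self k N j) (dg_braid k N i' j hi.symm)
  change (i : ℕ) + 1 < (j.1 : ℕ) + 1
  omega

/-! ### The elements `∂_w` -/

open Classical in
/-- The element `∂_w`, computed from a reduced expression of `w`. -/
noncomputable def dgPerm (N : ℕ) (w : Equiv.Perm (Fin N)) : NH k N :=
  if h : ∃ i : DIdx N, w i.succ < w i.1 then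
    dgPerm N (w * adjSwap h.choose) * dg k N h.choose
  else 1
termination_by permLength N w
decreasing_by exact permLength_mul_adjSwap_lt w _ h.choose_spec

lemma adjSwap_apply_of_ne {N : ℕ} (i : DIdx N) {a : Fin N} (h1 : a ≠ i.1) (h2 : a ≠ i.succ) :
    adjSwap i a = a :=
  Equiv.swap_apply_of_ne_of_ne h1 h2

lemma adjSwap_apply_of_far {N : ℕ} {i j : DIdx N}
    (h : (i.1 : ℕ) + 1 < (j.1 : ℕ) ∨ (j.1 : ℕ) + 1 < (i.1 : ℕ)) :
    adjSwap i j.1 = j.1 ∧ adjSwap i j.succ = j.succ := by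
  constructor <;> apply adjSwap_apply_of_ne <;> simp only [ne_eq, Fin.ext_iff] <;> omega

lemma adjSwap_comm {N : ℕ} {i j : DIdx N}
    (h : (i.1 : ℕ) + 1 < (j.1 : ℕ) ∨ (j.1 : ℕ) + 1 < (i.1 : ℕ)) :
    adjSwap i * adjSwap j = adjSwap j * adjSwap i := by
  rw [adjSwap, adjSwap, Equiv.mul_swap_eq_swap_mul, (adjSwap_apply_of_far h).1,
    (adjSwap_apply_of_far h).2]

lemma adjSwap_apply_of_succ {N : ℕ} {i j : DIdx N} (h : (j.1 : ℕ) = (i.1 : ℕ) + 1) :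
    adjSwap i j.succ = j.succ ∧ adjSwap j i.1 = i.1 := by
  constructor <;> apply adjSwap_apply_of_ne <;> simp only [ne_eq, Fin.ext_iff] <;> omega

lemma adjSwap_braid {N : ℕ} {i j : DIdx N} (h : (j.1 : ℕ) = (i.1 : ℕ) + 1) :
    adjSwap i * adjSwap j * adjSwap i = adjSwap j * adjSwap i * adjSwap j := by
  have hji : j.1 = i.succ := Fin.ext h
  obtain ⟨h1, h2⟩ := adjSwap_apply_of_succ h
  have hl : adjSwap i * adjSwap j * adjSwap i = Equiv.swap i.1 j.succ := by
    rw [adjSwap, adjSwap, Equiv.mul_swap_eq_swap_mul (adjSwap i), mul_assoc,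
      Equiv.swap_mul_self, mul_one, h1, hji, adjSwap_apply_right]
  have hr : adjSwap j * adjSwap i * adjSwap j = Equiv.swap i.1 j.succ := by
    rw [adjSwap, adjSwap, Equiv.mul_swap_eq_swap_mul (adjSwap j), mul_assoc,
      Equiv.swap_mul_self, mul_one, h2, ← hji, adjSwap_apply_left]
  rw [hl, hr]

theorem dgPerm_of_descent (N : ℕ) (w : Equiv.Perm (Fin N)) (i : DIdx N)
    (hi : w i.succ < w i.1) :
    dgPerm k N w = dgPerm k N (w * adjSwap i) * dg k N i := by
  induction hl : permLength N w using Nat.strong_induction_on generalizing w i with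
  | _ l ih =>
  have ih' : ∀ (v : Equiv.Perm (Fin N)) (a : DIdx N), permLength N v < permLength N w →
      v a.succ < v a.1 → dgPerm k N v = dgPerm k N (v * adjSwap a) * dg k N a :=
    fun v a hv ha => ih _ (hl ▸ hv) v a ha rfl
  have braid_case : ∀ a b : DIdx N, (b.1 : ℕ) = (a.1 : ℕ) + 1 → w a.succ < w a.1 →
      w b.succ < w b.1 → dgPerm k N (w * adjSwap a) * dg k N a =
        dgPerm k N (w * adjSwap b) * dg k N b := by
    intro a b hab ha hb
    have hbe : b.1 = a.succ := Fin.ext hab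
    obtain ⟨h1, h2⟩ := adjSwap_apply_of_succ hab
    have hla := permLength_mul_adjSwap_lt w a ha
    have hlb := permLength_mul_adjSwap_lt w b hb
    have hab1 : (w * adjSwap a) b.succ < (w * adjSwap a) b.1 := by
      rw [Equiv.Perm.mul_apply, Equiv.Perm.mul_apply, h1, hbe, adjSwap_apply_right]
      exact (hbe ▸ hb).trans ha
    have hba1 : (w * adjSwap b) a.succ < (w * adjSwap b) a.1 := by
      rw [Equiv.Perm.mul_apply, Equiv.Perm.mul_apply, h2, ← hbe, adjSwap_apply_left]
      exact hb.trans (hbe ▸ ha)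
    have hab2 : (w * adjSwap a * adjSwap b) a.succ < (w * adjSwap a * adjSwap b) a.1 := by
      simp only [Equiv.Perm.mul_apply]
      rw [h2, adjSwap_apply_left, ← hbe, adjSwap_apply_left, h1]
      exact hb
    have hba2 : (w * adjSwap b * adjSwap a) b.succ < (w * adjSwap b * adjSwap a) b.1 := by
      simp only [Equiv.Perm.mul_apply]
      rw [h1, adjSwap_apply_right, hbe, adjSwap_apply_right, h2]
      exact ha
    rw [ih' _ b hla hab1, ih' _ a hlb hba1,
      ih' _ a ((permLength_mul_adjSwap_lt _ b hab1).trans hla) hab2,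
      ih' _ b ((permLength_mul_adjSwap_lt _ a hba1).trans hlb) hba2,
      mul_assoc w, mul_assoc w, mul_assoc w, mul_assoc w, adjSwap_braid hab,
      mul_assoc _ (dg k N a), mul_assoc _ (dg k N a * _), dg_braid k N a b hab]
    simp only [mul_assoc]
  have far_case : ∀ a b : DIdx N, (a.1 : ℕ) + 1 < (b.1 : ℕ) ∨ (b.1 : ℕ) + 1 < (a.1 : ℕ) →
      w a.succ < w a.1 → w b.succ < w b.1 → dgPerm k N (w * adjSwap a) * dg k N a =
        dgPerm k N (w * adjSwap b) * dg k N b := by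
    intro a b hab ha hb
    obtain ⟨h1, h2⟩ := adjSwap_apply_of_far hab
    obtain ⟨h3, h4⟩ := adjSwap_apply_of_far hab.symm
    rw [ih' (w * adjSwap a) b (permLength_mul_adjSwap_lt w a ha) (by simpa [h1, h2] using hb),
      ih' (w * adjSwap b) a (permLength_mul_adjSwap_lt w b hb) (by simpa [h3, h4] using ha),
      mul_assoc w, mul_assoc w, adjSwap_comm hab, mul_assoc, mul_assoc, dg_comm k N a b hab]
  have hex : ∃ i : DIdx N, w i.succ < w i.1 := ⟨i, hi⟩
  rw [dgPerm, dif_pos hex]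
  have hj := hex.choose_spec
  generalize hex.choose = j at hj ⊢
  rcases lt_trichotomy (i.1 : ℕ) (j.1 : ℕ) with hij | hij | hij
  · rcases Nat.lt_or_ge ((i.1 : ℕ) + 1) (j.1 : ℕ) with hfar | hnear
    · exact (far_case i j (Or.inl hfar) hi hj).symm
    · exact (braid_case i j (by omega) hi hj).symm
  · rw [show i = j from Subtype.ext (Fin.ext hij)]
  · rcases Nat.lt_or_ge ((j.1 : ℕ) + 1) (i.1 : ℕ) with hfar | hnear
    · exact far_case j i (Or.inl hfar) hj hi
    · exact braid_case j i (by omega) hj hi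

theorem isDfam_dgPerm (N : ℕ) : IsDfam k N (dgPerm k N) := by
  refine ⟨?_, fun w i hi => ?_⟩
  · rw [dgPerm, dif_neg]
    rintro ⟨i, hi⟩
    exact lt_asymm hi i.lt_succ
  · rw [dgPerm_of_descent k N (w * adjSwap i) i (by simpa using hi), mul_adjSwap_cancel]

variable {k} in
lemma IsDfam.mul_dg_of_descent {N : ℕ} {Dm : Equiv.Perm (Fin N) → NH k N}
    (hD : IsDfam k N Dm) (w : Equiv.Perm (Fin N)) (i : DIdx N) (hi : w i.succ < w i.1) :
    Dm w * dg k N i = 0 := by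
  have h := hD.2 _ i (mul_adjSwap_lt w i hi)
  rw [mul_adjSwap_cancel] at h
  rw [h, mul_assoc, dg_mul_self, mul_zero]

/-! ### The polynomial subalgebra and the spanning set -/

open scoped IsMulCommutative in
/-- The homomorphism `k[x_1, …, x_N] → NH_N`. -/
noncomputable def nhPoly (N : ℕ) : MvPolynomial (Fin N) k →ₐ[k] NH k N :=
  haveI : IsMulCommutative (Algebra.adjoin k (Set.range (xg k N))) :=
    Algebra.isMulCommutative_adjoin k (by
      rintro _ ⟨i, rfl⟩ _ ⟨j, rfl⟩
      exact xg_comm k N i j)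
  (Algebra.adjoin k (Set.range (xg k N))).val.comp
    (MvPolynomial.aeval (S₁ := Algebra.adjoin k (Set.range (xg k N))) fun i =>
      ⟨xg k N i, Algebra.subset_adjoin ⟨i, rfl⟩⟩)

@[simp] lemma nhPoly_X (N : ℕ) (i : Fin N) :
    nhPoly k N (MvPolynomial.X i) = xg k N i := by
  simp [nhPoly]

/-- A subspace of `NH_N` containing `1` and stable under right
multiplication by the generators is everything. -/
lemma nh_submodule_eq_top (N : ℕ) (W : Submodule k (NH k N)) (one : 1 ∈ W)
    (hx : ∀ y ∈ W, ∀ i, y * xg k N i ∈ W) (hd : ∀ y ∈ W, ∀ i, y * dg k N i ∈ W) : W = ⊤ := by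
  have key : ∀ a : FreeAlgebra k (NHGen N), ∀ y ∈ W, y * nhMk k N a ∈ W := by
    intro a
    induction a using FreeAlgebra.induction with
    | grade0 r =>
      intro y hy
      rw [AlgHom.commutes, ← Algebra.commutes, ← Algebra.smul_def]
      exact W.smul_mem r hy
    | grade1 g =>
      intro y hy
      rcases g with i | i
      · exact hx y hy i
      · exact hd y hy i
    | mul a b ha hb =>
      intro y hy
      rw [map_mul, ← mul_assoc]
      exact hb _ (ha _ hy)
    | add a b ha hb =>
      intro y hy
      rw [map_add, mul_add]
      exact W.add_mem (ha _ hy) (hb _ hy)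
  refine eq_top_iff.mpr fun z _ => ?_
  obtain ⟨a, rfl⟩ := nhMk_surjective k N z
  simpa using key a 1 one

variable {k} in
/-- The elements `x^a ∂_w`, indexed by exponents and permutations. -/
noncomputable def nhMon {N : ℕ} (Dm : Equiv.Perm (Fin N) → NH k N)
    (p : (Fin N →₀ ℕ) × Equiv.Perm (Fin N)) : NH k N :=
  nhPoly k N (MvPolynomial.monomial p.1 1) * Dm p.2

variable {k} in
lemma nhPoly_mul_mem_span {N : ℕ} (Dm : Equiv.Perm (Fin N) → NH k N)
    (f : MvPolynomial (Fin N) k) (w : Equiv.Perm (Fin N)) :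
    nhPoly k N f * Dm w ∈ Submodule.span k (Set.range (nhMon Dm)) := by
  induction f using MvPolynomial.induction_on' with
  | monomial a r =>
    have : MvPolynomial.monomial a r = r • MvPolynomial.monomial a (1 : k) := by
      rw [MvPolynomial.smul_monomial, smul_eq_mul, mul_one]
    rw [this, map_smul, smul_mul_assoc]
    exact Submodule.smul_mem _ _ (Submodule.subset_span ⟨(a, w), rfl⟩)
  | add p q hp hq =>
    rw [map_add, add_mul]
    exact Submodule.add_mem _ hp hq

variable {k} in
lemma nhPoly_mul_mem_span_of_mem {N : ℕ} (Dm : Equiv.Perm (Fin N) → NH k N)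
    (f : MvPolynomial (Fin N) k) {y : NH k N}
    (hy : y ∈ Submodule.span k (Set.range (nhMon Dm))) :
    nhPoly k N f * y ∈ Submodule.span k (Set.range (nhMon Dm)) := by
  induction hy using Submodule.span_induction with
  | mem y hy =>
    obtain ⟨p, rfl⟩ := hy
    rw [nhMon, ← mul_assoc, ← map_mul]
    exact nhPoly_mul_mem_span Dm _ _
  | zero => simp
  | add y z _ _ hy hz => rw [mul_add]; exact Submodule.add_mem _ hy hz
  | smul r y _ hy => rw [mul_smul_comm]; exact Submodule.smul_mem _ _ hy

variable {k} in
theorem span_nhMon_eq_top {N : ℕ} {Dm : Equiv.Perm (Fin N) → NH k N} (hD : IsDfam k N Dm) :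
    Submodule.span k (Set.range (nhMon Dm)) = ⊤ := by
  set W := Submodule.span k (Set.range (nhMon Dm)) with hW
  have hDw : ∀ w, Dm w ∈ W := fun w => by
    simpa using nhPoly_mul_mem_span Dm 1 w
  have hd : ∀ y ∈ W, ∀ i, y * dg k N i ∈ W := by
    intro y hy i
    induction hy using Submodule.span_induction with
    | mem y hy =>
      obtain ⟨p, rfl⟩ := hy
      rw [nhMon, mul_assoc]
      rcases lt_or_gt_of_ne (p.2.injective.ne i.lt_succ.ne) with h | h
      · rw [← hD.2 _ _ h]
        exact nhPoly_mul_mem_span Dm _ _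
      · rw [hD.mul_dg_of_descent _ _ h, mul_zero]
        exact W.zero_mem
    | zero => simp
    | add y z _ _ hy hz => rw [add_mul]; exact W.add_mem hy hz
    | smul r y _ hy => rw [smul_mul_assoc]; exact W.smul_mem _ hy
  have hDx : ∀ w i, Dm w * xg k N i ∈ W := by
    intro w
    induction w using perm_ascent_induction with
    | one =>
      intro i
      rw [hD.1, one_mul]
      simpa [hD.1] using nhPoly_mul_mem_span Dm (MvPolynomial.X i) 1
    | step w j hj ih =>
      intro i
      rw [hD.2 w j hj, mul_assoc]
      by_cases h1 : i = j.1
      · rw [h1, dg_mul_xg_self, mul_add, mul_one, ← mul_assoc]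
        exact W.add_mem (hd _ (ih _) _) (hDw w)
      by_cases h2 : i = j.succ
      · rw [h2, dg_mul_xg_succ, mul_sub, mul_one, ← mul_assoc]
        exact W.sub_mem (hd _ (ih _) _) (hDw w)
      rw [← xg_dg_comm k N i j h1 h2, ← mul_assoc]
      exact hd _ (ih _) _
  refine nh_submodule_eq_top k N W (hD.1 ▸ hDw 1) (fun y hy i => ?_) hd
  induction hy using Submodule.span_induction with
  | mem y hy =>
    obtain ⟨p, rfl⟩ := hy
    rw [nhMon, mul_assoc]
    exact nhPoly_mul_mem_span_of_mem Dm _ (hDx _ _)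
  | zero => simp
  | add y z _ _ hy hz => rw [add_mul]; exact W.add_mem hy hz
  | smul r y _ hy => rw [smul_mul_assoc]; exact W.smul_mem _ hy

/-! ### The polynomial representation -/

section PolynomialRepresentation

variable (N : ℕ)

/-- The field of rational functions in `N` variables. -/
abbrev RatFun : Type := FractionRing (MvPolynomial (Fin N) k)

/-- The variable `x_i` as a rational function. -/
noncomputable def ratX (i : Fin N) : RatFun k N :=
  algebraMap (MvPolynomial (Fin N) k) (RatFun k N) (MvPolynomial.X i)

/-- The permutation action on rational functions. -/
noncomputable def permAct (w : Equiv.Perm (Fin N)) : RatFun k N ≃ₐ[k] RatFun k N :=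
  IsFractionRing.fieldEquivOfAlgEquivHom k (RatFun k N) (MvPolynomial.renameEquiv k w)

lemma permAct_algebraMap (w : Equiv.Perm (Fin N)) (f : MvPolynomial (Fin N) k) :
    permAct k N w (algebraMap _ _ f) = algebraMap _ _ (MvPolynomial.rename w f) := by
  simp [permAct]

lemma permAct_ratX (w : Equiv.Perm (Fin N)) (i : Fin N) :
    permAct k N w (ratX k N i) = ratX k N (w i) := by
  rw [ratX, permAct_algebraMap, MvPolynomial.rename_X, ratX]

lemma permAct_one : permAct k N 1 = 1 := by
  rw [permAct, show MvPolynomial.renameEquiv k (1 : Equiv.Perm (Fin N)) = 1 from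
    MvPolynomial.renameEquiv_refl k, map_one]

lemma permAct_mul (v w : Equiv.Perm (Fin N)) :
    permAct k N (v * w) = permAct k N v * permAct k N w := by
  rw [permAct, permAct, permAct, ← map_mul]
  congr 1
  exact (MvPolynomial.renameEquiv_trans k w v).symm

lemma permAct_permAct (v w : Equiv.Perm (Fin N)) (f : RatFun k N) :
    permAct k N v (permAct k N w f) = permAct k N (v * w) f := by
  rw [permAct_mul]; rfl

lemma ratX_injective : Function.Injective (ratX k N) :=
  (IsFractionRing.injective (MvPolynomial (Fin N) k) (RatFun k N)).comp
    (MvPolynomial.X_injective)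

lemma permAct_injective : Function.Injective (permAct k N) := by
  intro v w h
  refine Equiv.ext fun i => ratX_injective k N ?_
  rw [← permAct_ratX, ← permAct_ratX, h]

lemma ratX_sub_ne_zero {i j : Fin N} (h : i ≠ j) : ratX k N i - ratX k N j ≠ 0 :=
  sub_ne_zero.mpr fun he => h (ratX_injective k N he)

/-- The divided difference operator on rational functions. -/
noncomputable def divDiff (i : DIdx N) : Module.End k (RatFun k N) :=
  LinearMap.mulLeft k (ratX k N i.1 - ratX k N i.succ)⁻¹ ∘ₗ
    (LinearMap.id - (permAct k N (adjSwap i)).toLinearMap)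

lemma divDiff_apply (i : DIdx N) (f : RatFun k N) :
    divDiff k N i f =
      (f - permAct k N (adjSwap i) f) / (ratX k N i.1 - ratX k N i.succ) := by
  simp [divDiff, div_eq_inv_mul]

lemma permAct_adjSwap_permAct (i : DIdx N) (f : RatFun k N) :
    permAct k N (adjSwap i) (permAct k N (adjSwap i) f) = f := by
  rw [permAct_permAct, Equiv.swap_mul_self, permAct_one]; rfl

lemma divDiff_braid (i j : DIdx N) (h : (j.1 : ℕ) = (i.1 : ℕ) + 1) (f : RatFun k N) :
    divDiff k N i (divDiff k N j (divDiff k N i f)) =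
      divDiff k N j (divDiff k N i (divDiff k N j f)) := by
  have hji : j.1 = i.succ := Fin.ext h
  obtain ⟨h1, h2⟩ := adjSwap_apply_of_succ h
  have hb : permAct k N (adjSwap i) (permAct k N (adjSwap j) (permAct k N (adjSwap i) f)) =
      permAct k N (adjSwap j) (permAct k N (adjSwap i) (permAct k N (adjSwap j) f)) := by
    simp only [permAct_permAct, ← mul_assoc, adjSwap_braid h]
  have hr : adjSwap j i.succ = j.succ := by rw [← hji, adjSwap_apply_left]
  have n1 := ratX_sub_ne_zero k N i.lt_succ.ne
  have n2 := ratX_sub_ne_zero k N (hji ▸ j.lt_succ.ne)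
  have n3 := ratX_sub_ne_zero k N (i.lt_succ.trans (hji ▸ j.lt_succ)).ne
  have n1' := ratX_sub_ne_zero k N i.lt_succ.ne'
  have n2' := ratX_sub_ne_zero k N (hji ▸ j.lt_succ.ne')
  simp only [divDiff_apply, map_div₀, map_sub, permAct_ratX, permAct_adjSwap_permAct, hji,
    adjSwap_apply_left, adjSwap_apply_right, h1, h2, hr, hb]
  generalize permAct k N (adjSwap j) (permAct k N (adjSwap i) (permAct k N (adjSwap j) f)) = f₁
  generalize permAct k N (adjSwap j) (permAct k N (adjSwap i) f) = f₂
  generalize permAct k N (adjSwap i) (permAct k N (adjSwap j) f) = f₃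
  generalize permAct k N (adjSwap j) f = f₄
  generalize permAct k N (adjSwap i) f = f₅
  generalize ratX k N i.1 = x at *
  generalize ratX k N i.succ = y at *
  generalize ratX k N j.succ = z at *
  have e1 : y - x = -(x - y) := by ring
  have e2 : z - y = -(y - z) := by ring
  rw [e1, e2]
  field_simp
  ring

lemma divDiff_comm (i j : DIdx N)
    (h : (i.1 : ℕ) + 1 < (j.1 : ℕ) ∨ (j.1 : ℕ) + 1 < (i.1 : ℕ)) (f : RatFun k N) :
    divDiff k N i (divDiff k N j f) = divDiff k N j (divDiff k N i f) := by
  obtain ⟨h1, h2⟩ := adjSwap_apply_of_far h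
  obtain ⟨h3, h4⟩ := adjSwap_apply_of_far h.symm
  have hc : permAct k N (adjSwap i) (permAct k N (adjSwap j) f) =
      permAct k N (adjSwap j) (permAct k N (adjSwap i) f) := by
    simp only [permAct_permAct, adjSwap_comm h]
  simp only [divDiff_apply, map_div₀, map_sub, permAct_ratX, h1, h2, h3, h4, hc]
  have n1 := ratX_sub_ne_zero k N i.lt_succ.ne
  have n2 := ratX_sub_ne_zero k N j.lt_succ.ne
  field_simp
  ring

/-- The action of the generators of the nilHecke algebra on rational functions. -/
noncomputable def genAct : FreeAlgebra k (NHGen N) →ₐ[k] Module.End k (RatFun k N) :=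
  FreeAlgebra.lift k (Sum.elim (fun i => LinearMap.mulLeft k (ratX k N i)) (divDiff k N))

lemma genAct_x (i : Fin N) (f : RatFun k N) : genAct k N (NHx k N i) f = ratX k N i * f := by
  simp [genAct]

lemma genAct_d (i : DIdx N) : genAct k N (NHd k N i) = divDiff k N i := by
  simp [genAct]

lemma genAct_rel {a b : FreeAlgebra k (NHGen N)} (h : NHRel k N a b) :
    genAct k N a = genAct k N b := by
  refine LinearMap.ext fun f => ?_
  cases h with
  | xcomm i j =>
    simp only [map_mul, Module.End.mul_apply, genAct_x]
    ring
  | dsq i =>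
    have n1 := ratX_sub_ne_zero k N i.lt_succ.ne
    simp only [map_mul, Module.End.mul_apply, genAct_d, map_zero, LinearMap.zero_apply,
      divDiff_apply, map_div₀, map_sub, permAct_adjSwap_permAct, permAct_ratX,
      adjSwap_apply_left, adjSwap_apply_right]
    rw [← neg_sub (ratX k N i.1)]
    field_simp
    ring
  | braid i j h =>
    simp only [map_mul, Module.End.mul_apply, genAct_d]
    exact divDiff_braid k N i j h f
  | ddfar i j h =>
    simp only [map_mul, Module.End.mul_apply, genAct_d]
    exact divDiff_comm k N i j h f
  | xdfar i j h =>
    have hi : adjSwap j i = i := by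
      apply adjSwap_apply_of_ne <;> simp only [ne_eq, Fin.ext_iff] <;> omega
    simp only [map_mul, Module.End.mul_apply, genAct_d, genAct_x, divDiff_apply, permAct_ratX, hi]
    ring
  | xd i =>
    have n1 := ratX_sub_ne_zero k N i.lt_succ.ne
    simp only [map_mul, map_sub, map_one, LinearMap.sub_apply, Module.End.mul_apply,
      Module.End.one_apply, genAct_d, genAct_x, divDiff_apply, permAct_ratX, adjSwap_apply_right]
    field_simp
    ring
  | dx i =>
    have n1 := ratX_sub_ne_zero k N i.lt_succ.ne
    simp only [map_mul, map_sub, map_one, LinearMap.sub_apply, Module.End.mul_apply,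
      Module.End.one_apply, genAct_d, genAct_x, divDiff_apply, permAct_ratX, adjSwap_apply_left]
    field_simp
    ring

/-- The polynomial representation of the nilHecke algebra, extended to rational functions. -/
noncomputable def nhRep : NH k N →ₐ[k] Module.End k (RatFun k N) :=
  RingQuot.liftAlgHom k ⟨genAct k N, fun _ _ h => genAct_rel k N h⟩

lemma nhRep_nhMk (a : FreeAlgebra k (NHGen N)) : nhRep k N (nhMk k N a) = genAct k N a :=
  RingQuot.liftAlgHom_mkAlgHom_apply k _ _ a

lemma nhRep_x (i : Fin N) (f : RatFun k N) : nhRep k N (xg k N i) f = ratX k N i * f := by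
  rw [← nhMk_x, nhRep_nhMk, genAct_x]

lemma nhRep_d (i : DIdx N) : nhRep k N (dg k N i) = divDiff k N i := by
  rw [← nhMk_d, nhRep_nhMk, genAct_d]

lemma nhRep_nhPoly (p : MvPolynomial (Fin N) k) (f : RatFun k N) :
    nhRep k N (nhPoly k N p) f = algebraMap _ (RatFun k N) p * f := by
  have h : (nhRep k N).comp (nhPoly k N) = (Algebra.lmul k (RatFun k N)).comp
      (IsScalarTower.toAlgHom k (MvPolynomial (Fin N) k) (RatFun k N)) := by
    refine MvPolynomial.algHom_ext fun i => LinearMap.ext fun f => ?_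
    simp [nhRep_x, ratX]
  exact LinearMap.congr_fun (DFunLike.congr_fun h p) f

lemma nhRep_nhPoly_mul (p : MvPolynomial (Fin N) k) (y : NH k N) :
    nhRep k N (nhPoly k N p * y) = algebraMap _ (RatFun k N) p • nhRep k N y := by
  refine LinearMap.ext fun f => ?_
  rw [map_mul, Module.End.mul_apply, nhRep_nhPoly, LinearMap.smul_apply, smul_eq_mul]

lemma permAct_mem_range_nhRep (w : Equiv.Perm (Fin N)) :
    ∃ y, nhRep k N y = (permAct k N w).toLinearMap := by
  induction w using perm_ascent_induction with
  | one => exact ⟨1, by rw [permAct_one, map_one]; rfl⟩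
  | step w i _ ih =>
    obtain ⟨y, hy⟩ := ih
    refine ⟨y * (1 - (xg k N i.1 - xg k N i.succ) * dg k N i), LinearMap.ext fun f => ?_⟩
    have n1 := ratX_sub_ne_zero k N i.lt_succ.ne
    have hf : nhRep k N (1 - (xg k N i.1 - xg k N i.succ) * dg k N i) f =
        permAct k N (adjSwap i) f := by
      simp only [map_sub, map_mul, map_one, LinearMap.sub_apply, Module.End.mul_apply,
        Module.End.one_apply, nhRep_x, nhRep_d, divDiff_apply]
      field_simp
      ring
    rw [map_mul, Module.End.mul_apply, hf, hy, permAct_mul]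
    rfl

variable {k N}

lemma nhRep_mem_span {Dm : Equiv.Perm (Fin N) → NH k N} (hD : IsDfam k N Dm) (y : NH k N) :
    nhRep k N y ∈ Submodule.span (RatFun k N) (Set.range fun w => nhRep k N (Dm w)) := by
  have hy : y ∈ Submodule.span k (Set.range (nhMon Dm)) := span_nhMon_eq_top hD ▸ trivial
  induction hy using Submodule.span_induction with
  | mem y hy =>
    obtain ⟨p, rfl⟩ := hy
    rw [nhMon, nhRep_nhPoly_mul]
    exact Submodule.smul_mem _ _ (Submodule.subset_span ⟨p.2, rfl⟩)
  | zero => simp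
  | add y z _ _ hy hz => rw [map_add]; exact Submodule.add_mem _ hy hz
  | smul r y _ hy => rw [map_smul]; exact Submodule.smul_of_tower_mem _ r hy

lemma linearIndependent_nhRep {Dm : Equiv.Perm (Fin N) → NH k N} (hD : IsDfam k N Dm) :
    LinearIndependent (RatFun k N) fun w => nhRep k N (Dm w) := by
  have hσ : LinearIndependent (RatFun k N)
      fun w : Equiv.Perm (Fin N) => (permAct k N w).toLinearMap :=
    (linearIndependent_toLinearMap k (RatFun k N) (RatFun k N)).comp
      (fun w => (permAct k N w).toAlgHom) fun v w h => permAct_injective k N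
        (AlgEquiv.ext fun f => DFunLike.congr_fun h f)
  rw [linearIndependent_iff_card_le_finrank_span,
    linearIndependent_iff_card_eq_finrank_span.mp hσ]
  have : FiniteDimensional (RatFun k N)
      (Submodule.span (RatFun k N) (Set.range fun w => nhRep k N (Dm w))) :=
    FiniteDimensional.span_of_finite _ (Set.finite_range _)
  refine Submodule.finrank_mono (Submodule.span_le.mpr ?_)
  rintro _ ⟨w, rfl⟩
  obtain ⟨y, hy⟩ := permAct_mem_range_nhRep k N w
  have h := nhRep_mem_span hD y
  rw [hy] at h
  exact h

theorem linearIndependent_nhMon {Dm : Equiv.Perm (Fin N) → NH k N} (hD : IsDfam k N Dm) :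
    LinearIndependent k (nhMon Dm) := by
  have hmon : LinearIndependent k fun a : Fin N →₀ ℕ =>
      algebraMap (MvPolynomial (Fin N) k) (RatFun k N) (MvPolynomial.monomial a 1) := by
    have := (MvPolynomial.basisMonomials (Fin N) k).linearIndependent.map'
      (IsScalarTower.toAlgHom k (MvPolynomial (Fin N) k) (RatFun k N)).toLinearMap
      (LinearMap.ker_eq_bot.mpr (IsFractionRing.injective _ _))
    simpa [Function.comp_def] using this
  refine LinearIndependent.of_comp (nhRep k N).toLinearMap ?_
  have h := linearIndependent_smul hmon (linearIndependent_nhRep hD)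
  have he : (nhRep k N).toLinearMap ∘ nhMon Dm = fun p =>
      algebraMap (MvPolynomial (Fin N) k) (RatFun k N) (MvPolynomial.monomial p.1 1) •
        nhRep k N (Dm p.2) := funext fun p => nhRep_nhPoly_mul k N _ _
  rw [he]
  exact h

end PolynomialRepresentation

/-! ### Block permutations and minimal coset representatives -/

section YoungSubgroup

variable {n m : ℕ}

/-- The block permutation `u × v`, as an element of `S_{n+m}`. -/
def blockPerm (u : Equiv.Perm (Fin n)) (v : Equiv.Perm (Fin m)) : Equiv.Perm (Fin (n + m)) :=
  finSumFinEquiv.permCongr (Equiv.sumCongr u v)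

@[simp] lemma blockPerm_castAdd (u : Equiv.Perm (Fin n)) (v : Equiv.Perm (Fin m)) (i : Fin n) :
    blockPerm u v (Fin.castAdd m i) = Fin.castAdd m (u i) := by
  simp [blockPerm, Equiv.permCongr_apply]

@[simp] lemma blockPerm_natAdd (u : Equiv.Perm (Fin n)) (v : Equiv.Perm (Fin m)) (j : Fin m) :
    blockPerm u v (Fin.natAdd n j) = Fin.natAdd n (v j) := by
  simp [blockPerm, Equiv.permCongr_apply]

lemma blockPerm_one : blockPerm (1 : Equiv.Perm (Fin n)) (1 : Equiv.Perm (Fin m)) = 1 :=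
  Equiv.ext fun i => by cases i using Fin.addCases <;> simp

lemma blockPerm_mul (u u' : Equiv.Perm (Fin n)) (v v' : Equiv.Perm (Fin m)) :
    blockPerm (u * u') (v * v') = blockPerm u v * blockPerm u' v' :=
  Equiv.ext fun i => by cases i using Fin.addCases <;> simp

lemma blockPerm_inv (u : Equiv.Perm (Fin n)) (v : Equiv.Perm (Fin m)) :
    (blockPerm u v)⁻¹ = blockPerm u⁻¹ v⁻¹ := by
  rw [inv_eq_iff_mul_eq_one, ← blockPerm_mul, mul_inv_cancel, mul_inv_cancel, blockPerm_one]

lemma blockPerm_injective {u u' : Equiv.Perm (Fin n)} {v v' : Equiv.Perm (Fin m)}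
    (h : blockPerm u v = blockPerm u' v') : u = u' ∧ v = v' := by
  constructor <;> refine Equiv.ext fun i => ?_
  · simpa using DFunLike.congr_fun h (Fin.castAdd m i)
  · simpa using DFunLike.congr_fun h (Fin.natAdd n i)

lemma mem_young_iff_exists_blockPerm {w : Equiv.Perm (Fin (n + m))} :
    w ∈ young n m ↔ ∃ u v, w = blockPerm u v := by
  constructor
  · intro hw
    obtain ⟨⟨u, v⟩, huv⟩ := Equiv.Perm.mem_sumCongrHom_range_of_perm_mapsTo_inl
      (σ := finSumFinEquiv.symm.permCongr w) (by
        rintro _ ⟨i, rfl⟩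
        have h := hw (Fin.castAdd m i) (by simp)
        refine ⟨⟨_, h⟩, ?_⟩
        rw [Equiv.permCongr_apply, Equiv.eq_symm_apply]
        simp)
    refine ⟨u, v, ?_⟩
    rw [Equiv.Perm.sumCongrHom_apply] at huv
    change w = finSumFinEquiv.permCongr (Equiv.sumCongr u v)
    rw [← Equiv.symm_apply_eq, Equiv.permCongr_symm]
    exact huv.symm
  · rintro ⟨u, v, rfl⟩ i hi
    have : i = Fin.castAdd m ⟨i, hi⟩ := rfl
    rw [this, blockPerm_castAdd]
    simp

lemma young_inv_mem {w : Equiv.Perm (Fin (n + m))} (hw : w ∈ young n m) : w⁻¹ ∈ young n m := by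
  obtain ⟨u, v, rfl⟩ := mem_young_iff_exists_blockPerm.mp hw
  exact mem_young_iff_exists_blockPerm.mpr ⟨_, _, blockPerm_inv u v⟩

lemma young_mul_mem {w w' : Equiv.Perm (Fin (n + m))} (hw : w ∈ young n m)
    (hw' : w' ∈ young n m) : w * w' ∈ young n m :=
  fun i hi => hw _ (hw' i hi)

lemma young_apply_lt_iff {w : Equiv.Perm (Fin (n + m))} (hw : w ∈ young n m)
    (i : Fin (n + m)) : (w i : ℕ) < n ↔ (i : ℕ) < n :=
  ⟨fun h => by simpa using young_inv_mem hw (w i) h, hw i⟩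

/-- The permutations `w` such that `w⁻¹` is increasing on each of the two blocks. -/
def IsShuffle (n m : ℕ) (w : Equiv.Perm (Fin (n + m))) : Prop :=
  ∀ a b : Fin (n + m), a < b → ((a : ℕ) < n ↔ (b : ℕ) < n) → w⁻¹ a < w⁻¹ b

lemma isShuffle_of_mem_minReps {w : Equiv.Perm (Fin (n + m))} (hw : w ∈ minReps n m) :
    IsShuffle n m w := by
  have hadj : ∀ i : DIdx (n + m), ((i.1 : ℕ) < n ↔ (i.succ : ℕ) < n) →
      w⁻¹ i.1 < w⁻¹ i.succ := by
    intro i hi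
    by_contra h
    have hlt : w⁻¹ i.succ < w⁻¹ i.1 :=
      lt_of_le_of_ne (not_lt.mp h) fun he => i.lt_succ.ne (w⁻¹.injective he).symm
    refine (permLength_adjSwap_mul_lt w i hlt).not_ge (hw _ ?_)
    rw [mul_inv_cancel_right]
    intro j hj
    by_cases h1 : j = i.1
    · subst h1
      rw [adjSwap_apply_left]
      exact hi.mp hj
    by_cases h2 : j = i.succ
    · subst h2
      rw [adjSwap_apply_right]
      exact hi.mpr hj
    · rwa [adjSwap_apply_of_ne i h1 h2]
  have key : ∀ d (a b : Fin (n + m)), (b : ℕ) = a + d + 1 → ((a : ℕ) < n ↔ (b : ℕ) < n) →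
      w⁻¹ a < w⁻¹ b := by
    intro d
    induction d with
    | zero =>
      intro a b hab h
      have ha : (a : ℕ) + 1 < n + m := by omega
      obtain rfl : DIdx.succ ⟨a, ha⟩ = b := Fin.ext hab.symm
      exact hadj ⟨a, ha⟩ h
    | succ d ih =>
      intro a b hab h
      have hc : (a : ℕ) + d + 1 + 1 < n + m := by omega
      have hc' : (a : ℕ) + d + 1 < n + m := by omega
      refine (ih a ⟨a + d + 1, hc'⟩ rfl (by simp only; omega)).trans ?_
      obtain rfl : DIdx.succ ⟨⟨a + d + 1, hc'⟩, hc⟩ = b := Fin.ext hab.symm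
      refine hadj ⟨⟨a + d + 1, hc'⟩, hc⟩ ?_
      simp only at h ⊢
      omega
  intro a b hab h
  exact key (b - a - 1) a b (by rw [Fin.lt_def] at hab; omega) h

lemma IsShuffle.eq_of_mul_eq_mul {w w' : Equiv.Perm (Fin (n + m))} (hw : IsShuffle n m w)
    (hw' : IsShuffle n m w') {y y' : Equiv.Perm (Fin (n + m))} (hy : y ∈ young n m)
    (hy' : y' ∈ young n m) (h : y * w = y' * w') : w = w' := by
  have hz : y'⁻¹ * y ∈ young n m := young_mul_mem (young_inv_mem hy') hy
  set z := y'⁻¹ * y with hzdef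
  have hzw : z * w = w' := by rw [hzdef, mul_assoc, h, inv_mul_cancel_left]
  have hmono : StrictMono z := by
    intro a b hab
    by_cases hblock : (a : ℕ) < n ↔ (b : ℕ) < n
    · by_contra hlt
      have hlt' : z b < z a :=
        lt_of_le_of_ne (not_lt.mp hlt) fun he => hab.ne (z.injective he).symm
      have h1 := hw' _ _ hlt' (by
        rw [young_apply_lt_iff hz, young_apply_lt_iff hz, hblock])
      have h2 : ∀ c, w'⁻¹ (z c) = w⁻¹ c := fun c => by
        rw [Equiv.Perm.inv_eq_iff_eq, ← hzw]
        simp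
      rw [h2, h2] at h1
      exact lt_asymm (hw a b hab hblock) h1
    · have h1 := young_apply_lt_iff hz a
      have h2 := young_apply_lt_iff hz b
      rw [Fin.lt_def] at hab ⊢
      omega
  rw [← hzw, perm_eq_one_of_strictMono hmono, one_mul]

lemma exists_mem_minReps (g : Equiv.Perm (Fin (n + m))) :
    ∃ w ∈ minReps n m, g * w⁻¹ ∈ young n m := by
  obtain ⟨w, hw, hmin⟩ := (Set.toFinite {v | v * g⁻¹ ∈ young n m}).exists_minimalFor
    (permLength (n + m)) _ ⟨g, by rw [Set.mem_ofPred_eq, mul_inv_cancel]; exact fun _ hi => hi⟩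
  refine ⟨w, fun v hv => ?_, ?_⟩
  · have hvg : v * g⁻¹ ∈ young n m := by
      simpa [mul_assoc] using young_mul_mem hv hw
    exact (le_total _ _).elim id fun h => hmin hvg h
  · simpa using young_inv_mem hw

/-- Every element of `S_{n+m}` is uniquely a block permutation times a minimal
representative. -/
lemma blockPerm_mul_bijective : Function.Bijective
    fun p : (Equiv.Perm (Fin n) × Equiv.Perm (Fin m)) × minReps n m =>
      blockPerm p.1.1 p.1.2 * p.2.1 := by
  constructor
  · rintro ⟨⟨u, v⟩, w, hw⟩ ⟨⟨u', v'⟩, w', hw'⟩ h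
    obtain rfl : w = w' := (isShuffle_of_mem_minReps hw).eq_of_mul_eq_mul
      (isShuffle_of_mem_minReps hw') (mem_young_iff_exists_blockPerm.mpr ⟨u, v, rfl⟩)
      (mem_young_iff_exists_blockPerm.mpr ⟨u', v', rfl⟩) h
    obtain ⟨rfl, rfl⟩ := blockPerm_injective (mul_right_cancel h)
    rfl
  · intro g
    obtain ⟨w, hw, hg⟩ := exists_mem_minReps g
    obtain ⟨u, v, huv⟩ := mem_young_iff_exists_blockPerm.mp hg
    exact ⟨((u, v), ⟨w, hw⟩), by simp [← huv]⟩

variable {k}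

lemma IsDfam.map_mul_of_isShuffle {Dm : Equiv.Perm (Fin (n + m)) → NH k (n + m)}
    (hD : IsDfam k (n + m) Dm) {y : Equiv.Perm (Fin (n + m))} (hy : y ∈ young n m)
    {w : Equiv.Perm (Fin (n + m))} (hw : IsShuffle n m w) : Dm (y * w) = Dm y * Dm w := by
  induction w using perm_ascent_induction with
  | one => rw [hD.1, mul_one, mul_one]
  | step w i hi ih =>
    have hcross : ¬ ((w i.1 : ℕ) < n ↔ (w i.succ : ℕ) < n) := fun h => by
      have := hw _ _ hi h
      simp only [mul_inv_rev, Equiv.Perm.mul_apply, Equiv.Perm.coe_inv, Equiv.symm_apply_apply,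
        Equiv.symm_swap, adjSwap_apply_left, adjSwap_apply_right] at this
      exact lt_asymm this i.lt_succ
    have hw' : IsShuffle n m w := by
      intro a b hab h
      have h1 := hw a b hab h
      simp only [mul_inv_rev, Equiv.Perm.mul_apply, Equiv.Perm.coe_inv, Equiv.symm_swap] at h1
      have h2 := adjSwap_lt_adjSwap i h1 ?_
      · simpa using h2
      · rintro ⟨ha, hb⟩
        have ha' : w⁻¹ a = i.succ := by
          simpa using congrArg (adjSwap i) ha
        have hb' : w⁻¹ b = i.1 := by
          simpa using congrArg (adjSwap i) hb
        rw [Equiv.Perm.inv_eq_iff_eq] at ha' hb'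
        exact lt_asymm hi (ha' ▸ hb' ▸ hab)
    have hlt : (y * w) i.1 < (y * w) i.succ := by
      have h1 := young_apply_lt_iff hy (w i.1)
      have h2 := young_apply_lt_iff hy (w i.succ)
      rw [Fin.lt_def] at hi
      rw [Equiv.Perm.mul_apply, Equiv.Perm.mul_apply, Fin.lt_def]
      omega
    rw [← mul_assoc, hD.2 _ i hlt, hD.2 _ i hi, ih hw', mul_assoc]

/-! ### The images of the standard spanning vectors -/

variable {φ : NH k n ⊗[k] NH k m →ₐ[k] NH k (n + m)}

lemma IsPhi.map_dgPerm_tmul_one (hφ : IsPhi k n m φ)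
    {Dm : Equiv.Perm (Fin (n + m)) → NH k (n + m)} (hD : IsDfam k (n + m) Dm)
    (u : Equiv.Perm (Fin n)) : φ (dgPerm k n u ⊗ₜ 1) = Dm (blockPerm u 1) := by
  induction u using perm_ascent_induction with
  | one => rw [(isDfam_dgPerm k n).1, blockPerm_one, hD.1,
      ← Algebra.TensorProduct.one_def, map_one]
  | step u i hi ih =>
    have h : blockPerm (u * adjSwap i) (1 : Equiv.Perm (Fin m)) = blockPerm u 1 *
        adjSwap ⟨Fin.castAdd m i.1, by have := i.2; simp only [Fin.val_castAdd]; omega⟩ := by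
      change _ = _ * Equiv.swap (Fin.castAdd m i.1) (Fin.castAdd m i.succ)
      nth_rewrite 1 [← mul_one (1 : Equiv.Perm (Fin m))]
      rw [blockPerm_mul]
      congr 1
      refine Equiv.ext fun j => ?_
      cases j using Fin.addCases with
      | left j =>
        rw [blockPerm_castAdd, (Fin.castAdd_injective n m).swap_apply]
      | right j =>
        rw [blockPerm_natAdd, Equiv.swap_apply_of_ne_of_ne] <;> simp [Fin.ext_iff] <;> omega
    have hlt : blockPerm u (1 : Equiv.Perm (Fin m)) (Fin.castAdd m i.1) <
        blockPerm u 1 (Fin.castAdd m i.succ) := by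
      rw [blockPerm_castAdd, blockPerm_castAdd]
      exact hi
    rw [h, hD.2 _ _ hlt, (isDfam_dgPerm k n).2 u i hi, ← ih, ← hφ.2.1, ← map_mul,
      Algebra.TensorProduct.tmul_mul_tmul, one_mul]

lemma IsPhi.map_dgPerm_tmul (hφ : IsPhi k n m φ)
    {Dm : Equiv.Perm (Fin (n + m)) → NH k (n + m)} (hD : IsDfam k (n + m) Dm)
    (u : Equiv.Perm (Fin n)) (v : Equiv.Perm (Fin m)) :
    φ (dgPerm k n u ⊗ₜ dgPerm k m v) = Dm (blockPerm u v) := by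
  induction v using perm_ascent_induction with
  | one => rw [(isDfam_dgPerm k m).1, hφ.map_dgPerm_tmul_one hD]
  | step v i hi ih =>
    have h : blockPerm u (v * adjSwap i) = blockPerm u v *
        adjSwap ⟨Fin.natAdd n i.1, by have := i.2; simp only [Fin.val_natAdd]; omega⟩ := by
      change _ = _ * Equiv.swap (Fin.natAdd n i.1) (Fin.natAdd n i.succ)
      nth_rewrite 1 [← mul_one u]
      rw [blockPerm_mul]
      congr 1
      refine Equiv.ext fun j => ?_
      cases j using Fin.addCases with
      | left j =>
        rw [blockPerm_castAdd, Equiv.swap_apply_of_ne_of_ne] <;> simp [Fin.ext_iff] <;> omega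
      | right j =>
        rw [blockPerm_natAdd, (Fin.natAdd_injective m n).swap_apply]
    have hlt : blockPerm u v (Fin.natAdd n i.1) < blockPerm u v (Fin.natAdd n i.succ) := by
      rw [blockPerm_natAdd, blockPerm_natAdd]
      exact (Fin.natAdd_lt_natAdd_iff n).mpr hi
    have hd : φ ((1 : NH k n) ⊗ₜ dg k m i) = dg k (n + m)
        ⟨Fin.natAdd n i.1, by have := i.2; simp only [Fin.val_natAdd]; omega⟩ := hφ.2.2.2 i
    have hD2 := hD.2 (blockPerm u v)
      ⟨Fin.natAdd n i.1, by have := i.2; simp only [Fin.val_natAdd]; omega⟩ hlt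
    rw [h, hD2, (isDfam_dgPerm k m).2 v i hi, ← ih, ← hd, ← map_mul,
      Algebra.TensorProduct.tmul_mul_tmul, mul_one]

lemma IsPhi.map_nhPoly_tmul (hφ : IsPhi k n m φ) (p : MvPolynomial (Fin n) k)
    (q : MvPolynomial (Fin m) k) : φ (nhPoly k n p ⊗ₜ nhPoly k m q) =
      nhPoly k (n + m) (MvPolynomial.rename (Fin.castAdd m) p *
        MvPolynomial.rename (Fin.natAdd n) q) := by
  have h1 : (φ.comp Algebra.TensorProduct.includeLeft).comp (nhPoly k n) =
      (nhPoly k (n + m)).comp (MvPolynomial.rename (Fin.castAdd m)) :=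
    MvPolynomial.algHom_ext fun i => by simp [hφ.1]
  have h2 : (φ.comp Algebra.TensorProduct.includeRight).comp (nhPoly k m) =
      (nhPoly k (n + m)).comp (MvPolynomial.rename (Fin.natAdd n)) :=
    MvPolynomial.algHom_ext fun i => by simp [hφ.2.2.1]
  have e : nhPoly k n p ⊗ₜ[k] nhPoly k m q = (nhPoly k n p ⊗ₜ 1) * (1 ⊗ₜ nhPoly k m q) := by
    rw [Algebra.TensorProduct.tmul_mul_tmul, one_mul, mul_one]
  rw [e, map_mul, map_mul]
  exact congrArg₂ _ (DFunLike.congr_fun h1 p) (DFunLike.congr_fun h2 q)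

/-- The exponent vector on `n + m` variables obtained by concatenation. -/
noncomputable def appendExponent (a : Fin n →₀ ℕ) (b : Fin m →₀ ℕ) : Fin (n + m) →₀ ℕ :=
  a.mapDomain (Fin.castAdd m) + b.mapDomain (Fin.natAdd n)

lemma appendExponent_castAdd (a : Fin n →₀ ℕ) (b : Fin m →₀ ℕ) (i : Fin n) :
    appendExponent a b (Fin.castAdd m i) = a i := by
  rw [appendExponent, Finsupp.add_apply, Finsupp.mapDomain_apply (Fin.castAdd_injective n m),
    Finsupp.mapDomain_of_notMem_range, add_zero]
  rintro ⟨j, hj⟩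
  simp [Fin.ext_iff] at hj
  omega

lemma appendExponent_natAdd (a : Fin n →₀ ℕ) (b : Fin m →₀ ℕ) (j : Fin m) :
    appendExponent a b (Fin.natAdd n j) = b j := by
  rw [appendExponent, Finsupp.add_apply, Finsupp.mapDomain_apply (Fin.natAdd_injective m n),
    Finsupp.mapDomain_of_notMem_range, zero_add]
  rintro ⟨i, hi⟩
  simp [Fin.ext_iff] at hi
  omega

lemma appendExponent_bijective : Function.Bijective
    fun p : (Fin n →₀ ℕ) × (Fin m →₀ ℕ) => appendExponent p.1 p.2 := by
  constructor
  · rintro ⟨a, b⟩ ⟨a', b'⟩ h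
    refine Prod.ext (Finsupp.ext fun i => ?_) (Finsupp.ext fun i => ?_)
    · simpa only [appendExponent_castAdd] using DFunLike.congr_fun h (Fin.castAdd m i)
    · simpa only [appendExponent_natAdd] using DFunLike.congr_fun h (Fin.natAdd n i)
  · intro c
    refine ⟨(c.comapDomain _ (Fin.castAdd_injective n m).injOn,
      c.comapDomain _ (Fin.natAdd_injective m n).injOn), Finsupp.ext fun i => ?_⟩
    cases i using Fin.addCases with
    | left i => simp only [appendExponent_castAdd, Finsupp.comapDomain_apply]
    | right i => simp only [appendExponent_natAdd, Finsupp.comapDomain_apply]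

lemma IsPhi.map_nhMon_tmul_mul (hφ : IsPhi k n m φ)
    {Dm : Equiv.Perm (Fin (n + m)) → NH k (n + m)} (hD : IsDfam k (n + m) Dm)
    (p : (Fin n →₀ ℕ) × Equiv.Perm (Fin n)) (q : (Fin m →₀ ℕ) × Equiv.Perm (Fin m))
    {w : Equiv.Perm (Fin (n + m))} (hw : w ∈ minReps n m) :
    φ (nhMon (dgPerm k n) p ⊗ₜ nhMon (dgPerm k m) q) * Dm w =
      nhMon Dm (appendExponent p.1 q.1, blockPerm p.2 q.2 * w) := by
  rw [nhMon, nhMon, nhMon, ← Algebra.TensorProduct.tmul_mul_tmul, map_mul,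
    hφ.map_nhPoly_tmul, hφ.map_dgPerm_tmul hD, MvPolynomial.rename_monomial,
    MvPolynomial.rename_monomial, MvPolynomial.monomial_mul, one_mul, mul_assoc,
    ← hD.map_mul_of_isShuffle (mem_young_iff_exists_blockPerm.mpr ⟨_, _, rfl⟩)
      (isShuffle_of_mem_minReps hw)]
  rfl

end YoungSubgroup

lemma span_tmul_eq_top {R M P ι κ : Type*} [CommSemiring R] [AddCommMonoid M] [AddCommMonoid P]
    [Module R M] [Module R P] {f : ι → M} {g : κ → P}
    (hf : Submodule.span R (Set.range f) = ⊤) (hg : Submodule.span R (Set.range g) = ⊤) :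
    Submodule.span R (Set.range fun p : ι × κ => f p.1 ⊗ₜ[R] g p.2) = ⊤ := by
  rw [← TensorProduct.map₂_mk_top_top_eq_top, ← hf, ← hg, Submodule.map₂_span_span,
    Set.image2_range]
  rfl

lemma bijective_of_linearIndependent_of_span {R M P ι : Type*} [Ring R] [AddCommGroup M]
    [AddCommGroup P] [Module R M] [Module R P] (F : M →ₗ[R] P) {e : ι → M}
    (he : Submodule.span R (Set.range e) = ⊤) (hli : LinearIndependent R (F ∘ e))
    (hs : Submodule.span R (Set.range (F ∘ e)) = ⊤) : Function.Bijective F := by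
  refine ⟨LinearMap.ker_eq_bot.mp ?_, LinearMap.range_eq_top.mp ?_⟩
  · have h := Submodule.range_ker_disjoint hli
    rwa [he, top_disjoint] at h
  · rw [← hs, Set.range_comp, ← Submodule.map_span, he, Submodule.map_top]

/-- let `k` be a field, `n, m ≥ 1`, and `D` the set of minimal-length
representatives of the right cosets `(S_n × S_m)\S_{n+m}`.  Then the `k`-linear map
`(NH_n ⊗_k NH_m) ⊗_k k^{(D)} → NH_{n+m}` sending `a ⊗ δ_w ↦ φ(a)·∂_w` is bijective;
i.e. `NH_{n+m}` is a free left `(NH_n ⊗_k NH_m)`-module (via `φ`) with basis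
`{∂_w : w ∈ D}`.  Here `Dm = (∂_w)_w` and `φ` are characterized by `IsDfam`/`IsPhi`. -/
theorem stmt_11 (n m : ℕ) (hn : 1 ≤ n) (hm : 1 ≤ m)
    (φ : NH k n ⊗[k] NH k m →ₐ[k] NH k (n + m)) (hφ : IsPhi k n m φ)
    (Dm : Equiv.Perm (Fin (n + m)) → NH k (n + m)) (hDm : IsDfam k (n + m) Dm)
    (F : ((NH k n ⊗[k] NH k m) ⊗[k] ((minReps n m) →₀ k)) →ₗ[k] NH k (n + m))
    (hF : ∀ (a : NH k n) (b : NH k m) (w : minReps n m),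
      F ((a ⊗ₜ[k] b) ⊗ₜ[k] Finsupp.single w 1) = φ (a ⊗ₜ[k] b) * Dm w.1) :
    Function.Bijective F := by
  let σ : (((Fin n →₀ ℕ) × Equiv.Perm (Fin n)) × ((Fin m →₀ ℕ) × Equiv.Perm (Fin m))) ×
      minReps n m → (Fin (n + m) →₀ ℕ) × Equiv.Perm (Fin (n + m)) := fun p =>
    (appendExponent p.1.1.1 p.1.2.1, blockPerm p.1.1.2 p.1.2.2 * p.2.1)
  have hσ : Function.Bijective σ := by
    constructor
    · rintro ⟨⟨⟨a, u⟩, ⟨b, v⟩⟩, w⟩ ⟨⟨⟨a', u'⟩, ⟨b', v'⟩⟩, w'⟩ h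
      have h1 := appendExponent_bijective.1 (a₁ := (a, b)) (a₂ := (a', b')) (congrArg Prod.fst h)
      have h2 := blockPerm_mul_bijective.1 (a₁ := ((u, v), w)) (a₂ := ((u', v'), w'))
        (congrArg Prod.snd h)
      simp only [Prod.mk.injEq] at h1 h2 ⊢
      tauto
    · rintro ⟨c, g⟩
      obtain ⟨⟨a, b⟩, h1⟩ := appendExponent_bijective.2 c
      obtain ⟨⟨⟨u, v⟩, w⟩, h2⟩ := blockPerm_mul_bijective.2 g
      exact ⟨(((a, u), (b, v)), w), Prod.ext h1 h2⟩
  have hFe : F ∘ (fun p : (((Fin n →₀ ℕ) × Equiv.Perm (Fin n)) ×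
      ((Fin m →₀ ℕ) × Equiv.Perm (Fin m))) × minReps n m =>
      (nhMon (dgPerm k n) p.1.1 ⊗ₜ[k] nhMon (dgPerm k m) p.1.2) ⊗ₜ[k]
        Finsupp.basisSingleOne (R := k) p.2) = nhMon Dm ∘ σ := by
    funext p
    rw [Finsupp.coe_basisSingleOne]
    exact (hF _ _ _).trans (hφ.map_nhMon_tmul_mul hDm _ _ p.2.2)
  refine bijective_of_linearIndependent_of_span F
    (span_tmul_eq_top (span_tmul_eq_top (span_nhMon_eq_top (isDfam_dgPerm k n))
      (span_nhMon_eq_top (isDfam_dgPerm k m)))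
      (Finsupp.basisSingleOne (R := k) (ι := minReps n m)).span_eq) ?_ ?_
  · rw [hFe]
    exact (linearIndependent_nhMon hDm).comp σ hσ.injective
  · rw [hFe, hσ.surjective.range_comp, span_nhMon_eq_top hDm]
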